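/- arXiv:1207.0775 — 9 statements merged into one kernel-verified Lean document; each statement's English description precedes it below -/
import Mathlib

section
/- For every x ∈ ℝ^n, the optimization problem min_{v ∈ ℝ^n} { max_{1≤i≤m} ⟨∇f_i(x), v⟩ + (1/2)‖v‖² } has exactly one solution. Moreover, a vector v ∈ ℝ^n is the solution of this problem if and only if there exist scalars α_i ≥ 0 for i ∈ I(x,v) with Σ_{i∈I(x,v)} α_i = 1 and v = −Σ_{i∈I(x,v)} α_i ∇f_i(x), where I(x,v) := { i ∈ {1,…,m} : ⟨∇f_i(x), v⟩ = max_{1≤j≤m} ⟨∇f_j(x), v⟩ }. -/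
open scoped Classical

noncomputable section

/-- `ℝ^n` as a Euclidean space. -/
abbrev E (n : ℕ) := EuclideanSpace ℝ (Fin n)

/-- The objective of the steepest-descent direction subproblem:
`v ↦ max_{1≤i≤m} ⟨∇f_i(x), v⟩ + (1/2)‖v‖²`. -/
def phi {n m : ℕ} (f : Fin m → E n → ℝ) (x v : E n) : ℝ :=
  (⨆ i, (inner ℝ (gradient (f i) x) v : ℝ)) + (1 / 2) * ‖v‖ ^ 2

/-- The set of indices attaining the max `I(x,v)`. -/
def maxSet {n m : ℕ} (f : Fin m → E n → ℝ) (x v : E n) : Finset (Fin m) :=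
  Finset.univ.filter fun i =>
    (inner ℝ (gradient (f i) x) v : ℝ) = ⨆ j, (inner ℝ (gradient (f j) x) v : ℝ)

/-- The point of least norm in the convex hull of a finite nonempty family, with convex weights
and the variational inequality that characterises it. -/
lemma exists_stdSimplex_inner_sum_ge {ι H : Type*} [Fintype ι] [Nonempty ι]
    [NormedAddCommGroup H] [InnerProductSpace ℝ H] (g : ι → H) :
    ∃ w ∈ stdSimplex ℝ ι, ∀ i,
      ‖∑ j, w j • g j‖ ^ 2 ≤ (inner ℝ (g i) (∑ j, w j • g j) : ℝ) := by
  let L : (ι → ℝ) →ₗ[ℝ] H := Fintype.linearCombination ℝ g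
  have hL : ∀ w, L w = ∑ j, w j • g j := fun w => Fintype.linearCombination_apply ℝ g w
  have hcont : Continuous L := by
    rw [show (L : (ι → ℝ) → H) = fun w => ∑ j, w j • g j from funext hL]
    fun_prop
  have hconv : Convex ℝ (L '' stdSimplex ℝ ι) := (convex_stdSimplex ℝ ι).linear_image L
  have hmem : ∀ i, g i ∈ L '' stdSimplex ℝ ι := fun i =>
    ⟨Pi.single i 1, single_mem_stdSimplex ℝ i, by simp [hL, Pi.single_apply, ite_smul]⟩
  obtain ⟨p, hp, hmin⟩ := exists_norm_eq_iInf_of_complete_convex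
    ⟨_, hmem (Classical.arbitrary ι)⟩ ((isCompact_stdSimplex ℝ ι).image hcont).isComplete
    hconv 0
  have hvar := (norm_eq_iInf_iff_real_inner_le_zero hconv hp).1 hmin
  obtain ⟨w, hw, rfl⟩ := hp
  refine ⟨w, hw, fun i => ?_⟩
  have h := hvar (g i) (hmem i)
  rw [zero_sub, inner_neg_left, inner_sub_right, real_inner_self_eq_norm_sq,
    real_inner_comm, hL] at h
  linarith

section Multipliers

variable {n m : ℕ} {f : Fin m → E n → ℝ} {x v : E n}

/-- Convex multipliers on the active indices express `v` as minus a convex combination of the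
active gradients. -/
def HasMultipliers (f : Fin m → E n → ℝ) (x v : E n) : Prop :=
  ∃ α : Fin m → ℝ,
    (∀ i ∈ maxSet f x v, 0 ≤ α i) ∧
    (∑ i ∈ maxSet f x v, α i) = 1 ∧
    v = -∑ i ∈ maxSet f x v, α i • gradient (f i) x

/-- Multipliers force quadratic growth of the objective around `v`. -/
lemma HasMultipliers.phi_add_le (h : HasMultipliers f x v) (u : E n) :
    phi f x v + (1 / 2) * ‖u - v‖ ^ 2 ≤ phi f x u := by
  obtain ⟨α, hα, hsum, hv⟩ := h
  have hcomb : ∀ z : E n,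
      ∑ i ∈ maxSet f x v, α i * (inner ℝ (gradient (f i) x) z : ℝ) = -inner ℝ v z := by
    intro z
    conv_rhs => rw [hv]
    simp [inner_neg_left, sum_inner, real_inner_smul_left]
  have hmax : (⨆ j, (inner ℝ (gradient (f j) x) v : ℝ)) = -‖v‖ ^ 2 := by
    rw [← real_inner_self_eq_norm_sq, ← hcomb v,
      Finset.sum_congr rfl fun i hi => by rw [(Finset.mem_filter.1 hi).2],
      ← Finset.sum_mul, hsum, one_mul]
  have hle : -inner ℝ v u ≤ ⨆ j, (inner ℝ (gradient (f j) x) u : ℝ) := by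
    rw [← hcomb u, ← one_mul (⨆ j, (inner ℝ (gradient (f j) x) u : ℝ)), ← hsum, Finset.sum_mul]
    exact Finset.sum_le_sum fun i hi =>
      mul_le_mul_of_nonneg_left (le_ciSup (f := fun j => (inner ℝ (gradient (f j) x) u : ℝ))
        (Set.finite_range _).bddAbove i) (hα i hi)
  have hsq := norm_sub_sq_real u v
  rw [real_inner_comm] at hsq
  unfold phi
  linarith

/-- Some direction admits multipliers. -/
lemma exists_hasMultipliers (hm : 0 < m) (f : Fin m → E n → ℝ) (x : E n) :
    ∃ v, HasMultipliers f x v := by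
  have : Nonempty (Fin m) := ⟨⟨0, hm⟩⟩
  obtain ⟨w, ⟨hw0, hw1⟩, hw⟩ := exists_stdSimplex_inner_sum_ge fun i => gradient (f i) x
  set p := ∑ j, w j • gradient (f j) x with hp
  have hzero : ∀ i, w i * ((inner ℝ (gradient (f i) x) p : ℝ) - ‖p‖ ^ 2) = 0 := by
    have hs : ∑ i, w i * ((inner ℝ (gradient (f i) x) p : ℝ) - ‖p‖ ^ 2) = 0 := by
      have : ∑ i, w i * (inner ℝ (gradient (f i) x) p : ℝ) = ‖p‖ ^ 2 := by
        rw [← real_inner_self_eq_norm_sq]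
        conv_rhs => rw [hp, sum_inner]
        simp [real_inner_smul_left, ← hp]
      simp only [mul_sub, Finset.sum_sub_distrib, this, ← Finset.sum_mul, hw1, one_mul, sub_self]
    intro i
    exact (Finset.sum_eq_zero_iff_of_nonneg fun i _ =>
      mul_nonneg (hw0 i) (sub_nonneg.2 (hw i))).1 hs i (Finset.mem_univ i)
  have hactive : ∀ i, w i ≠ 0 → i ∈ maxSet f x (-p) := by
    intro i hi
    have heq : (inner ℝ (gradient (f i) x) p : ℝ) = ‖p‖ ^ 2 :=
      sub_eq_zero.1 ((mul_eq_zero.1 (hzero i)).resolve_left hi)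
    refine Finset.mem_filter.2 ⟨Finset.mem_univ i, le_antisymm
      (le_ciSup (f := fun j => (inner ℝ (gradient (f j) x) (-p) : ℝ))
        (Set.finite_range _).bddAbove i) (ciSup_le fun j => ?_)⟩
    rw [inner_neg_right, inner_neg_right, heq]
    exact neg_le_neg (hw j)
  have hout : ∀ i ∉ maxSet f x (-p), w i = 0 := fun i hi => by
    by_contra h
    exact hi (hactive i h)
  refine ⟨-p, w, fun i _ => hw0 i, ?_, ?_⟩
  · rw [← hw1]
    exact Finset.sum_subset (Finset.subset_univ _) fun i _ hi => hout i hi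
  · rw [neg_inj, hp]
    exact (Finset.sum_subset (Finset.subset_univ _) fun i _ hi => by
      rw [hout i hi, zero_smul]).symm

end Multipliers

theorem stmt_0 {n m : ℕ} (hm : 0 < m) (f : Fin m → E n → ℝ)
    (hf : ∀ i, ContDiff ℝ 1 (f i)) (x : E n) :
    (∃! v : E n, ∀ u : E n, phi f x v ≤ phi f x u) ∧
      ∀ v : E n,
        (∀ u : E n, phi f x v ≤ phi f x u) ↔
          ∃ α : Fin m → ℝ,
            (∀ i ∈ maxSet f x v, 0 ≤ α i) ∧
            (∑ i ∈ maxSet f x v, α i) = 1 ∧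
            v = -∑ i ∈ maxSet f x v, α i • gradient (f i) x := by
  obtain ⟨v₀, h₀⟩ := exists_hasMultipliers hm f x
  have hmin : ∀ v, HasMultipliers f x v → ∀ u, phi f x v ≤ phi f x u := fun v h u => by
    have := h.phi_add_le u
    nlinarith [sq_nonneg ‖u - v‖]
  have huniq : ∀ v, (∀ u, phi f x v ≤ phi f x u) → v = v₀ := fun v h => by
    have hgrow := h₀.phi_add_le v
    have hle := h v₀
    have hsq : ‖v - v₀‖ ^ 2 = 0 := le_antisymm (by linarith) (sq_nonneg _)
    exact sub_eq_zero.1 (norm_eq_zero.1 (pow_eq_zero_iff two_ne_zero |>.1 hsq))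
  refine ⟨⟨v₀, hmin v₀ h₀, huniq⟩, fun v => ⟨fun h => ?_, hmin v⟩⟩
  rw [huniq v h]
  exact h₀
end
end

section
/- If x ∈ ℝ^n is a critical Pareto point of F and v(x) denotes the unique solution of min_{v ∈ ℝ^n} { max_{1≤i≤m} ⟨∇f_i(x), v⟩ + (1/2)‖v‖² }, then v(x) = 0 and the optimal value α(x) := max_{1≤i≤m} ⟨∇f_i(x), v(x)⟩ + (1/2)‖v(x)‖² is equal to zero. -/
open scoped Classical

noncomputable section

/-- `x` is a critical Pareto point: no direction `v` has `⟨∇f_i(x), v⟩ < 0` for all `i`. -/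
def IsParetoCritical {n m : ℕ} (f : Fin m → E n → ℝ) (x : E n) : Prop :=
  ¬ ∃ v : E n, ∀ i, (inner ℝ (gradient (f i) x) v : ℝ) < 0

theorem stmt_1 {n m : ℕ} (hm : 0 < m) (f : Fin m → E n → ℝ)
    (hf : ∀ i, ContDiff ℝ 1 (f i)) (x : E n)
    (hx : IsParetoCritical f x)
    (vx : E n) (hmin : ∀ u : E n, phi f x vx ≤ phi f x u) :
    vx = 0 ∧ phi f x vx = 0 := by
  have hzero : phi f x 0 = 0 := by simp [phi]
  obtain ⟨i, hi⟩ : ∃ i, 0 ≤ (inner ℝ (gradient (f i) x) vx : ℝ) := by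
    by_contra! h
    exact hx ⟨vx, h⟩
  have hsup : 0 ≤ ⨆ i, (inner ℝ (gradient (f i) x) vx : ℝ) :=
    hi.trans (le_ciSup (f := fun i => (inner ℝ (gradient (f i) x) vx : ℝ))
      (Set.finite_range _).bddAbove i)
  have hle : (⨆ i, (inner ℝ (gradient (f i) x) vx : ℝ)) + (1 / 2) * ‖vx‖ ^ 2 ≤ 0 :=
    (hmin 0).trans_eq hzero
  have hvx : vx = 0 := by
    rw [← norm_eq_zero, ← sq_eq_zero_iff]
    linarith [sq_nonneg ‖vx‖]
  exact ⟨hvx, hvx ▸ hzero⟩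
end
end

section
/- If x ∈ ℝ^n is not a critical Pareto point of F and v(x) denotes the unique solution of min_{v ∈ ℝ^n} { max_{1≤i≤m} ⟨∇f_i(x), v⟩ + (1/2)‖v‖² }, then v(x) ≠ 0 and max_{1≤i≤m} ⟨∇f_i(x), v(x)⟩ + (1/2)‖v(x)‖² < 0; in particular, ⟨∇f_i(x), v(x)⟩ < 0 for all i = 1,…,m, i.e., v(x) is a descent direction for F at x. -/
open scoped Classical

noncomputable section

/-- A direction along which every partial objective strictly decreases yields, after rescaling,
a point where the subproblem objective is negative. -/
lemma exists_phi_neg {n m : ℕ} (hm : 0 < m) (f : Fin m → E n → ℝ) (x w : E n)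
    (hw : ∀ i, (inner ℝ (gradient (f i) x) w : ℝ) < 0) : ∃ u : E n, phi f x u < 0 := by
  have : Nonempty (Fin m) := ⟨⟨0, hm⟩⟩
  obtain ⟨j, hj⟩ := Finite.exists_max fun i => (inner ℝ (gradient (f i) x) w : ℝ)
  set s : ℝ := inner ℝ (gradient (f j) x) w
  have hs : s < 0 := hw j
  have hN : 0 < ‖w‖ ^ 2 + 1 := by positivity
  obtain ⟨t, ht⟩ : ∃ t : ℝ, t * (‖w‖ ^ 2 + 1) = -s := ⟨-s / (‖w‖ ^ 2 + 1), by field_simp⟩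
  have ht0 : 0 < t := pos_of_mul_pos_left (by linarith) hN.le
  refine ⟨t • w, ?_⟩
  have hsup : (⨆ i, (inner ℝ (gradient (f i) x) (t • w) : ℝ)) ≤ t * s :=
    ciSup_le fun i => by
      rw [real_inner_smul_right]
      exact mul_le_mul_of_nonneg_left (hj i) ht0.le
  have hnorm : ‖t • w‖ ^ 2 = t ^ 2 * ‖w‖ ^ 2 := by
    rw [norm_smul, mul_pow, Real.norm_eq_abs, sq_abs]
  have hts : t * s = -(t ^ 2 * (‖w‖ ^ 2 + 1)) := by linear_combination t * ht
  have ht2 : 0 < t ^ 2 := by positivity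
  have : 0 ≤ t ^ 2 * ‖w‖ ^ 2 := by positivity
  rw [phi, hnorm]
  linarith

theorem stmt_2 {n m : ℕ} (hm : 0 < m) (f : Fin m → E n → ℝ)
    (hf : ∀ i, ContDiff ℝ 1 (f i)) (x : E n)
    (hx : ¬ IsParetoCritical f x)
    (vx : E n) (hmin : ∀ u : E n, phi f x vx ≤ phi f x u) :
    vx ≠ 0 ∧ phi f x vx < 0 ∧ ∀ i, (inner ℝ (gradient (f i) x) vx : ℝ) < 0 := by
  obtain ⟨w, hw⟩ := not_not.mp hx
  obtain ⟨u, hu⟩ := exists_phi_neg hm f x w hw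
  have hneg : phi f x vx < 0 := (hmin u).trans_lt hu
  refine ⟨?_, hneg, fun i => ?_⟩
  · rintro rfl
    simp [phi] at hneg
  · have hle : (inner ℝ (gradient (f i) x) vx : ℝ) ≤ ⨆ i, inner ℝ (gradient (f i) x) vx :=
      le_ciSup (f := fun i => (inner ℝ (gradient (f i) x) vx : ℝ)) (Set.finite_range _).bddAbove i
    have : 0 ≤ ‖vx‖ ^ 2 := by positivity
    rw [phi] at hneg
    linarith
end
end

section
/- The steepest descent direction function x ↦ v(x), mapping ℝ^n to ℝ^n, is continuous; in particular, the optimal value function x ↦ α(x), mapping ℝ^n to ℝ, is also continuous. -/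
open scoped Classical

noncomputable section

/-- A finite supremum of functionals `v ↦ ⟨g i, v⟩` is Lipschitz in the `g i`. -/
lemma ciSup_inner_le_add {n m : ℕ} [Nonempty (Fin m)] (g h : Fin m → E n) (u : E n) :
    (⨆ i, (inner ℝ (g i) u : ℝ)) ≤ (⨆ i, (inner ℝ (h i) u : ℝ)) + (∑ i, ‖g i - h i‖) * ‖u‖ := by
  refine ciSup_le fun i => ?_
  have h_sup : (inner ℝ (h i) u : ℝ) ≤ ⨆ i, (inner ℝ (h i) u : ℝ) :=
    le_ciSup (f := fun i => (inner ℝ (h i) u : ℝ)) (Set.finite_range _).bddAbove i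
  have h_diff : (inner ℝ (g i - h i) u : ℝ) ≤ ‖g i - h i‖ * ‖u‖ := real_inner_le_norm _ _
  have h_sum : ‖g i - h i‖ ≤ ∑ i, ‖g i - h i‖ :=
    Finset.single_le_sum (f := fun i => ‖g i - h i‖) (fun _ _ => norm_nonneg _)
      (Finset.mem_univ i)
  rw [inner_sub_left] at h_diff
  nlinarith [mul_le_mul_of_nonneg_right h_sum (norm_nonneg u)]

lemma phi_le_phi_add {n m : ℕ} [Nonempty (Fin m)] (f : Fin m → E n → ℝ) (x y u : E n) :
    phi f x u ≤ phi f y u + (∑ i, ‖gradient (f i) x - gradient (f i) y‖) * ‖u‖ := by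
  have := ciSup_inner_le_add (fun i => gradient (f i) x) (fun i => gradient (f i) y) u
  unfold phi
  linarith

/-- Midpoint strong convexity of the subproblem objective. -/
lemma phi_midpoint_le {n m : ℕ} [Nonempty (Fin m)] (f : Fin m → E n → ℝ) (x u w : E n) :
    phi f x ((1 / 2 : ℝ) • (u + w)) ≤
      (phi f x u + phi f x w) / 2 - ‖u - w‖ ^ 2 / 8 := by
  have h_sup : (⨆ i, (inner ℝ (gradient (f i) x) ((1 / 2 : ℝ) • (u + w)) : ℝ)) ≤
      ((⨆ i, (inner ℝ (gradient (f i) x) u : ℝ)) +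
        ⨆ i, (inner ℝ (gradient (f i) x) w : ℝ)) / 2 := by
    refine ciSup_le fun i => ?_
    have hu := le_ciSup (f := fun i => (inner ℝ (gradient (f i) x) u : ℝ))
      (Set.finite_range _).bddAbove i
    have hw := le_ciSup (f := fun i => (inner ℝ (gradient (f i) x) w : ℝ))
      (Set.finite_range _).bddAbove i
    rw [inner_smul_right, inner_add_right]
    linarith
  have h_norm : ‖(1 / 2 : ℝ) • (u + w)‖ = ‖u + w‖ / 2 := by
    rw [norm_smul, Real.norm_of_nonneg (by norm_num)]
    ring
  have h_par := parallelogram_law_with_norm ℝ u w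
  unfold phi
  rw [h_norm]
  nlinarith

/-- Quadratic growth of the subproblem objective around a minimizer. -/
lemma phi_quadratic_growth {n m : ℕ} [Nonempty (Fin m)] (f : Fin m → E n → ℝ) (x w : E n)
    (hw : ∀ u : E n, phi f x w ≤ phi f x u) (u : E n) :
    phi f x w + ‖u - w‖ ^ 2 / 4 ≤ phi f x u := by
  linarith [phi_midpoint_le f x u w, hw ((1 / 2 : ℝ) • (u + w))]

/-- Hölder-type stability of minimizers of the subproblem under perturbation of the gradients. -/
lemma norm_minimizer_sub_le {n m : ℕ} [Nonempty (Fin m)] (f : Fin m → E n → ℝ) (x y a b : E n)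
    (ha : ∀ u : E n, phi f x a ≤ phi f x u) (hb : ∀ u : E n, phi f y b ≤ phi f y u) :
    ‖b - a‖ ≤ (∑ i, ‖gradient (f i) y - gradient (f i) x‖) +
      √((∑ i, ‖gradient (f i) y - gradient (f i) x‖) ^ 2 +
        4 * (∑ i, ‖gradient (f i) y - gradient (f i) x‖) * ‖a‖) := by
  have h_symm : ∑ i, ‖gradient (f i) x - gradient (f i) y‖ =
      ∑ i, ‖gradient (f i) y - gradient (f i) x‖ :=
    Finset.sum_congr rfl fun i _ => norm_sub_rev _ _
  have h1 := phi_quadratic_growth f x a ha b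
  have h2 := phi_quadratic_growth f y b hb a
  have h3 := phi_le_phi_add f x y b
  have h4 := phi_le_phi_add f y x a
  rw [h_symm] at h3
  rw [norm_sub_rev a b] at h2
  have hD : 0 ≤ ∑ i, ‖gradient (f i) y - gradient (f i) x‖ :=
    Finset.sum_nonneg fun _ _ => norm_nonneg _
  set D := ∑ i, ‖gradient (f i) y - gradient (f i) x‖
  have h_tri : ‖b‖ ≤ ‖b - a‖ + ‖a‖ := norm_le_norm_sub_add b a
  have := mul_le_mul_of_nonneg_left h_tri hD
  have := Real.le_sqrt_of_sq_le (x := ‖b - a‖ - D) (y := D ^ 2 + 4 * D * ‖a‖) (by nlinarith)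
  linarith

lemma continuous_gradient_of_contDiff_one {n : ℕ} {f : E n → ℝ} (hf : ContDiff ℝ 1 f) :
    Continuous (gradient f) :=
  (InnerProductSpace.toDual ℝ (E n)).symm.continuous.comp (hf.continuous_fderiv one_ne_zero)

lemma continuous_phi_comp {n m : ℕ} [Nonempty (Fin m)] {f : Fin m → E n → ℝ}
    (hf : ∀ i, Continuous (gradient (f i))) {V : E n → E n} (hV : Continuous V) :
    Continuous fun x => phi f x (V x) := by
  unfold phi
  refine Continuous.add ?_ (by fun_prop)
  simp only [← Finset.sup'_univ_eq_ciSup]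
  exact Continuous.finset_sup'_apply _ fun i _ => (hf i).inner hV

theorem stmt_4 {n m : ℕ} (hm : 0 < m) (f : Fin m → E n → ℝ)
    (hf : ∀ i, ContDiff ℝ 1 (f i))
    (V : E n → E n) (hV : ∀ x u : E n, phi f x (V x) ≤ phi f x u) :
    Continuous V ∧ Continuous (fun x => phi f x (V x)) := by
  have : Nonempty (Fin m) := ⟨⟨0, hm⟩⟩
  have hg := fun i => continuous_gradient_of_contDiff_one (hf i)
  have hVc : Continuous V := by
    refine continuous_iff_continuousAt.2 fun x => tendsto_iff_norm_sub_tendsto_zero.2 ?_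
    refine squeeze_zero (fun _ => norm_nonneg _)
      (fun y => norm_minimizer_sub_le f x y (V x) (V y) (hV x) (hV y)) ?_
    refine Continuous.tendsto' (by fun_prop) _ _ ?_
    simp
  exact ⟨hVc, continuous_phi_comp hg hVc⟩
end
end

section
/- Let σ ∈ [0,1) and x ∈ ℝ^n. If v ∈ ℝ^n is a σ-approximate steepest descent direction at x, then ‖v − v(x)‖² ≤ 2σ|α(x)|. -/
open scoped Classical

noncomputable section

/-- The pointwise maximum of finitely many convex functions is convex. -/
theorem convexOn_ciSup_of_finite {V ι : Type*} [AddCommGroup V] [Module ℝ V] [Finite ι]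
    [Nonempty ι] {s : Set V} {g : ι → V → ℝ} (hg : ∀ i, ConvexOn ℝ s (g i)) :
    ConvexOn ℝ s fun v ↦ ⨆ i, g i v := by
  refine ⟨(hg (Classical.arbitrary ι)).1, fun u hu w hw a b ha hb hab ↦ ciSup_le fun i ↦ ?_⟩
  refine ((hg i).2 hu hw ha hb hab).trans ?_
  simp only [smul_eq_mul]
  gcongr
  · exact le_ciSup (Set.finite_range fun j ↦ g j u).bddAbove i
  · exact le_ciSup (Set.finite_range fun j ↦ g j w).bddAbove i

/-- A strongly convex function grows at least quadratically away from a minimizer. -/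
theorem StrongConvexOn.mul_sq_norm_sub_le {V : Type*} [NormedAddCommGroup V] [NormedSpace ℝ V]
    {s : Set V} {c : ℝ} {g : V → ℝ} (hg : StrongConvexOn s c g) {u v : V} (hu : u ∈ s)
    (hv : v ∈ s) (hmin : IsMinOn g s u) : c / 2 * ‖v - u‖ ^ 2 ≤ g v - g u := by
  have key : ∀ t ∈ Set.Ioo (0 : ℝ) 1, (1 - t) * (c / 2 * ‖v - u‖ ^ 2) ≤ g v - g u := by
    rintro t ⟨ht0, ht1⟩
    have h := (isMinOn_iff.1 hmin _ (hg.1 hv hu ht0.le (sub_nonneg.2 ht1.le) (by ring))).trans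
      (hg.2 hv hu ht0.le (sub_nonneg.2 ht1.le) (by ring))
    simp only [smul_eq_mul] at h
    refine le_of_mul_le_mul_left ?_ ht0
    linarith
  have hlim : Filter.Tendsto (fun t : ℝ ↦ (1 - t) * (c / 2 * ‖v - u‖ ^ 2))
      (nhdsWithin 0 (Set.Ioi 0)) (nhds ((1 - 0) * (c / 2 * ‖v - u‖ ^ 2))) :=
    (Continuous.tendsto (by fun_prop) 0).mono_left nhdsWithin_le_nhds
  rw [sub_zero, one_mul] at hlim
  exact le_of_tendsto hlim (Filter.mem_of_superset (Ioo_mem_nhdsGT one_pos) key)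

theorem strongConvexOn_phi {n m : ℕ} [NeZero m] (f : Fin m → E n → ℝ) (x : E n) :
    StrongConvexOn Set.univ 1 (phi f x) := by
  rw [strongConvexOn_iff_convex]
  simpa [phi] using convexOn_ciSup_of_finite fun i ↦
    (innerₛₗ ℝ (gradient (f i) x)).convexOn convex_univ

theorem stmt_7 {n m : ℕ} (hm : 0 < m) (f : Fin m → E n → ℝ)
    (hf : ∀ i, ContDiff ℝ 1 (f i)) (x : E n)
    (σ : ℝ) (hσ0 : 0 ≤ σ) (hσ1 : σ < 1)
    (vx : E n) (hmin : ∀ u : E n, phi f x vx ≤ phi f x u)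
    (v : E n) (happrox : phi f x v ≤ (1 - σ) * phi f x vx) :
    ‖v - vx‖ ^ 2 ≤ 2 * σ * |phi f x vx| := by
  have : NeZero m := ⟨hm.ne'⟩
  have hgrowth := (strongConvexOn_phi f x).mul_sq_norm_sub_le (Set.mem_univ vx) (Set.mem_univ v)
    (isMinOn_univ_iff.2 hmin)
  have habs := mul_le_mul_of_nonneg_left (neg_le_abs (phi f x vx)) hσ0
  linarith
end
end

section
/- Let σ ∈ [0,1), x ∈ ℝ^n, and suppose v = −Σ_{i=1}^m w_i ∇f_i(x) for some w in the unit simplex (w_i ≥ 0, Σ_{i=1}^m w_i = 1). If max_{1≤i≤m} ⟨∇f_i(x), v⟩ ≤ −(1 − σ/2)‖v‖², then v is a σ-approximate steepest descent direction at x. -/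
open scoped Classical

noncomputable section

/-- A convex combination of the slopes `⟨∇f_i(x), u⟩` bounds the subproblem objective from below,
uniformly in the direction `u`. -/
theorem neg_half_norm_sq_le_phi {n m : ℕ} (f : Fin m → E n → ℝ) (x u : E n)
    {w : Fin m → ℝ} (hw0 : ∀ i, 0 ≤ w i) (hw1 : (∑ i, w i) = 1) :
    -(1 / 2) * ‖∑ i, w i • gradient (f i) x‖ ^ 2 ≤ phi f x u := by
  have hsup : inner ℝ (∑ i, w i • gradient (f i) x) u
      ≤ ⨆ i, (inner ℝ (gradient (f i) x) u : ℝ) := by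
    rw [sum_inner]
    calc ∑ i, inner ℝ (w i • gradient (f i) x) u
        = ∑ i, w i * inner ℝ (gradient (f i) x) u := by simp only [real_inner_smul_left]
      _ ≤ ∑ i, w i * ⨆ j, (inner ℝ (gradient (f j) x) u : ℝ) := by
          gcongr with i
          · exact hw0 i
          · exact le_ciSup (f := fun j => (inner ℝ (gradient (f j) x) u : ℝ))
              (Set.finite_range _).bddAbove i
      _ = ⨆ i, (inner ℝ (gradient (f i) x) u : ℝ) := by rw [← Finset.sum_mul, hw1, one_mul]
  have hsq := norm_add_sq_real (∑ i, w i • gradient (f i) x) u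
  have := sq_nonneg ‖(∑ i, w i • gradient (f i) x) + u‖
  unfold phi
  linarith

theorem stmt_8 {n m : ℕ} (hm : 0 < m) (f : Fin m → E n → ℝ)
    (hf : ∀ i, ContDiff ℝ 1 (f i)) (x : E n)
    (σ : ℝ) (hσ0 : 0 ≤ σ) (hσ1 : σ < 1)
    (vx : E n) (hmin : ∀ u : E n, phi f x vx ≤ phi f x u)
    (v : E n) (w : Fin m → ℝ) (hw0 : ∀ i, 0 ≤ w i) (hw1 : (∑ i, w i) = 1)
    (hv : v = -∑ i, w i • gradient (f i) x)
    (hmax : (⨆ i, (inner ℝ (gradient (f i) x) v : ℝ)) ≤ -(1 - σ / 2) * ‖v‖ ^ 2) :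
    phi f x v ≤ (1 - σ) * phi f x vx := by
  have hlow := neg_half_norm_sq_le_phi f x vx hw0 hw1
  rw [← norm_neg, ← hv] at hlow
  calc phi f x v ≤ (1 - σ) * (-(1 / 2) * ‖v‖ ^ 2) := by
        unfold phi
        linarith
    _ ≤ (1 - σ) * phi f x vx := mul_le_mul_of_nonneg_left hlow (by linarith)
end
end

section
/- For every x ∈ ℝ^n: (i) α(x) = −(1/2)‖v(x)‖², and (ii) max_{1≤i≤m} ⟨∇f_i(x), v(x)⟩ = −‖v(x)‖². -/
open scoped Classical

noncomputable section

/-- If `t = 1` minimizes `t * M + t ^ 2 * N / 2` over `t ≥ 0`, with `N ≥ 0`, then the derivative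
`M + N` at `t = 1` vanishes. -/
theorem eq_neg_of_forall_le_quadratic {M N : ℝ} (hN : 0 ≤ N)
    (h : ∀ t : ℝ, 0 ≤ t → M + 1 / 2 * N ≤ t * M + 1 / 2 * (t ^ 2 * N)) : M = -N := by
  set A := M + N with hA
  set D := N + |A| + 1 with hD
  have hDpos : 0 < D := by positivity
  have hAD : A ≤ D := by linarith [le_abs_self A]
  have key := h (1 - A / D) (sub_nonneg.2 ((div_le_one hDpos).2 hAD))
  have hs : A / D * D = A := div_mul_cancel₀ A hDpos.ne'
  have hle : (A / D) ^ 2 * (D - N / 2) ≤ 0 := by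
    have : (A / D) ^ 2 * D = A / D * A := by rw [sq, mul_assoc, hs]
    rw [mul_sub, this]
    rw [hA] at key ⊢
    linarith
  have hpos : 0 < D - N / 2 := by linarith [abs_nonneg A]
  have hzero : A / D = 0 := by
    have := nonpos_of_mul_nonpos_left hle hpos
    exact pow_eq_zero_iff two_ne_zero |>.1 (le_antisymm this (sq_nonneg _))
  have : A = 0 := by rw [← hs, hzero, zero_mul]
  linarith

theorem phi_smul {n m : ℕ} (f : Fin m → E n → ℝ) (x v : E n) {t : ℝ} (ht : 0 ≤ t) :
    phi f x (t • v) =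
      t * (⨆ i, (inner ℝ (gradient (f i) x) v : ℝ)) + 1 / 2 * (t ^ 2 * ‖v‖ ^ 2) := by
  simp only [phi, inner_smul_right, norm_smul, mul_pow, Real.norm_eq_abs, sq_abs,
    Real.mul_iSup_of_nonneg ht]

theorem stmt_9 {n m : ℕ} (hm : 0 < m) (f : Fin m → E n → ℝ)
    (hf : ∀ i, ContDiff ℝ 1 (f i)) (x : E n)
    (vx : E n) (hmin : ∀ u : E n, phi f x vx ≤ phi f x u) :
    phi f x vx = -(1 / 2) * ‖vx‖ ^ 2 ∧
      (⨆ i, (inner ℝ (gradient (f i) x) vx : ℝ)) = -‖vx‖ ^ 2 := by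
  have hmax : (⨆ i, (inner ℝ (gradient (f i) x) vx : ℝ)) = -‖vx‖ ^ 2 :=
    eq_neg_of_forall_le_quadratic (sq_nonneg _) fun t ht => by
      rw [← phi_smul f x vx ht]
      exact hmin (t • vx)
  refine ⟨?_, hmax⟩
  rw [phi, hmax]
  ring
end
end

section
/- If {x^k} is an infinite sequence generated by the inexact steepest descent method with Armijo rule and {x^k} has an accumulation point, then Σ_{k=0}^∞ t_k |α(x^k)| < +∞ and Σ_{k=0}^∞ t_k ‖v^k‖² < +∞; in particular Σ_{k=0}^∞ t_k² ‖v^k‖² < +∞ and lim_{k→∞} t_k ‖v^k‖² = 0. -/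
open scoped Classical Topology

noncomputable section

/-- The optimal value `α(x)` of the steepest-descent direction subproblem. -/
def alphaVal {n m : ℕ} (f : Fin m → E n → ℝ) (x : E n) : ℝ :=
  ⨅ v : E n, phi f x v

/-- The set of candidate Armijo step sizes `2^{-j}` at `x` in direction `v`. -/
def ArmijoSet {n m : ℕ} (f : Fin m → E n → ℝ) (β : ℝ) (x v : E n) : Set ℝ :=
  {s : ℝ | ∃ j : ℕ, s = (2 : ℝ) ^ (-(j : ℤ)) ∧
    ∀ i, f i (x + s • v) ≤ f i x + β * s * (inner ℝ (gradient (f i) x) v : ℝ)}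

/-- The inexact steepest descent method with Armijo rule: at each iteration `k`,
`x k` is not a critical Pareto point, `v k` is a `σ`-approximate steepest descent
direction at `x k`, `t k` is the largest Armijo step size `2^{-j}`, and
`x (k+1) = x k + t k • v k`. -/
structure IsInexactSDMethod {n m : ℕ} (f : Fin m → E n → ℝ) (β σ : ℝ)
    (x v : ℕ → E n) (t : ℕ → ℝ) : Prop where
  hβ0 : 0 < β
  hβ1 : β < 1
  hσ0 : 0 ≤ σ
  hσ1 : σ < 1
  not_crit : ∀ k, ¬ IsParetoCritical f (x k)
  approx : ∀ k, phi f (x k) (v k) ≤ (1 - σ) * alphaVal f (x k)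
  step_mem : ∀ k, t k ∈ ArmijoSet f β (x k) (v k)
  step_max : ∀ k, ∀ s ∈ ArmijoSet f β (x k) (v k), s ≤ t k
  update : ∀ k, x (k + 1) = x k + t k • v k

theorem phi_zero {n m : ℕ} (f : Fin m → E n → ℝ) (x : E n) : phi f x 0 = 0 := by
  simp [phi]

theorem alphaVal_nonpos {n m : ℕ} (f : Fin m → E n → ℝ) (x : E n) : alphaVal f x ≤ 0 := by
  by_cases h : BddBelow (Set.range (phi f x))
  · exact (ciInf_le h 0).trans_eq (phi_zero f x)
  · exact (Real.iInf_of_not_bddBelow h).le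

theorem inner_gradient_le_phi_sub {n m : ℕ} (f : Fin m → E n → ℝ) (x v : E n) (i : Fin m) :
    (inner ℝ (gradient (f i) x) v : ℝ) ≤ phi f x v - (1 / 2) * ‖v‖ ^ 2 := by
  have h := le_ciSup (Set.finite_range fun j => (inner ℝ (gradient (f j) x) v : ℝ)).bddAbove i
  simpa [phi] using h

theorem Antitone.le_of_mapClusterPt {a : ℕ → ℝ} (ha : Antitone a) {c : ℝ}
    (hc : MapClusterPt c Filter.atTop a) (k : ℕ) : c ≤ a k := by
  by_contra! h
  obtain ⟨j, hj, hkj⟩ :=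
    ((hc.frequently (Ioi_mem_nhds h)).and_eventually (Filter.eventually_ge_atTop k)).exists
  exact absurd (ha hkj) (not_le.mpr hj)

theorem Antitone.summable_sub_succ_of_mapClusterPt {a : ℕ → ℝ} (ha : Antitone a) {c : ℝ}
    (hc : MapClusterPt c Filter.atTop a) : Summable fun k => a k - a (k + 1) := by
  refine summable_of_sum_range_le (c := a 0 - c) (fun k => sub_nonneg.mpr (ha k.le_succ))
    fun k => ?_
  rw [Finset.sum_range_sub']
  linarith [ha.le_of_mapClusterPt hc k]

theorem ArmijoSet.pos_and_le_one {n m : ℕ} {f : Fin m → E n → ℝ} {β : ℝ} {x v : E n} {s : ℝ}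
    (hs : s ∈ ArmijoSet f β x v) : 0 < s ∧ s ≤ 1 := by
  obtain ⟨j, rfl, -⟩ := hs
  refine ⟨by positivity, ?_⟩
  rw [zpow_neg, zpow_natCast]
  exact inv_le_one_of_one_le₀ (one_le_pow₀ one_le_two)

theorem IsInexactSDMethod.sufficient_decrease {n m : ℕ} {f : Fin m → E n → ℝ} {β σ : ℝ}
    {x v : ℕ → E n} {t : ℕ → ℝ} (h : IsInexactSDMethod f β σ x v t) (i : Fin m) (k : ℕ) :
    β * (1 - σ) * (t k * |alphaVal f (x k)|) + β / 2 * (t k * ‖v k‖ ^ 2) ≤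
      f i (x k) - f i (x (k + 1)) := by
  obtain ⟨ht, -⟩ := ArmijoSet.pos_and_le_one (h.step_mem k)
  obtain ⟨-, -, hdec⟩ := h.step_mem k
  have hd := hdec i
  rw [← h.update k] at hd
  have hinner : (inner ℝ (gradient (f i) (x k)) (v k) : ℝ) ≤
      (1 - σ) * alphaVal f (x k) - (1 / 2) * ‖v k‖ ^ 2 :=
    (inner_gradient_le_phi_sub f (x k) (v k) i).trans (sub_le_sub_right (h.approx k) _)
  have hmul := mul_le_mul_of_nonneg_left hinner (mul_pos h.hβ0 ht).le
  rw [abs_of_nonpos (alphaVal_nonpos f (x k))]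
  linarith

theorem stmt_12 {n m : ℕ} (hm : 0 < m) (f : Fin m → E n → ℝ)
    (hf : ∀ i, ContDiff ℝ 1 (f i)) (β σ : ℝ)
    (x v : ℕ → E n) (t : ℕ → ℝ)
    (hmethod : IsInexactSDMethod f β σ x v t)
    (hacc : ∃ p : E n, MapClusterPt p Filter.atTop x) :
    Summable (fun k => t k * |alphaVal f (x k)|) ∧
      Summable (fun k => t k * ‖v k‖ ^ 2) ∧
      Summable (fun k => t k ^ 2 * ‖v k‖ ^ 2) ∧
      Filter.Tendsto (fun k => t k * ‖v k‖ ^ 2) Filter.atTop (𝓝 0) := by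
  obtain ⟨p, hp⟩ := hacc
  let i : Fin m := ⟨0, hm⟩
  have hβ := hmethod.hβ0
  have hσ : 0 < 1 - σ := sub_pos.mpr hmethod.hσ1
  have ht k := ArmijoSet.pos_and_le_one (hmethod.step_mem k)
  have hdec := hmethod.sufficient_decrease i
  have hα k : 0 ≤ t k * |alphaVal f (x k)| := mul_nonneg (ht k).1.le (abs_nonneg _)
  have hv k : 0 ≤ t k * ‖v k‖ ^ 2 := mul_nonneg (ht k).1.le (sq_nonneg _)
  have hα' k := mul_nonneg (mul_pos hβ hσ).le (hα k)
  have hv' k := mul_nonneg (half_pos hβ).le (hv k)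
  have hanti : Antitone fun k => f i (x k) :=
    antitone_nat_of_succ_le fun k => by linarith [hdec k, hα' k, hv' k]
  have hsum : Summable fun k => f i (x k) - f i (x (k + 1)) :=
    hanti.summable_sub_succ_of_mapClusterPt
      (hp.continuousAt_comp (hf i).continuous.continuousAt)
  have hsα : Summable fun k => t k * |alphaVal f (x k)| :=
    (summable_mul_left_iff (mul_pos hβ hσ).ne').mp
      (hsum.of_nonneg_of_le hα' fun k => by linarith [hdec k, hv' k])
  have hsv : Summable fun k => t k * ‖v k‖ ^ 2 :=
    (summable_mul_left_iff (half_pos hβ).ne').mp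
      (hsum.of_nonneg_of_le hv' fun k => by linarith [hdec k, hα' k])
  refine ⟨hsα, hsv, hsv.of_nonneg_of_le (fun k => by positivity) fun k => ?_,
    hsv.tendsto_atTop_zero⟩
  exact mul_le_mul_of_nonneg_right (pow_le_of_le_one (ht k).1.le (ht k).2 two_ne_zero)
    (sq_nonneg _)
end
end

section
/- Suppose F is quasi-convex, {x^k}, {v^k}, {t_k} are generated by the inexact steepest descent method with Armijo rule, and for every k there exists w^k in the unit simplex (w^k_i ≥ 0, Σ_{i=1}^m w^k_i = 1) with v^k = −Σ_{i=1}^m w^k_i ∇f_i(x^k). If x̃ ∈ ℝ^n satisfies F(x̃) ⪯ F(x^k) for all k, then for every k: ‖x^{k+1} − x̃‖² ≤ ‖x^k − x̃‖² + t_k² ‖v^k‖². -/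
open scoped Classical Topology

noncomputable section

/-- A vector function (given by its components) is quasi-convex if
`F((1-t)x + ty) ⪯ max{F(x), F(y)}` coordinatewise for all `t ∈ [0,1]`. -/
def VecQuasiConvex {n m : ℕ} (f : Fin m → E n → ℝ) : Prop :=
  ∀ x y : E n, ∀ t ∈ Set.Icc (0 : ℝ) 1, ∀ i,
    f i ((1 - t) • x + t • y) ≤ max (f i x) (f i y)

/-- A differentiable function quasi-convex along the segment from `x` to `y` with `f y ≤ f x`
does not increase to first order at `x` in the direction `y - x`. -/
theorem inner_gradient_nonpos_of_quasiconvex {H : Type*} [NormedAddCommGroup H]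
    [InnerProductSpace ℝ H] [CompleteSpace H] {f : H → ℝ} {x y : H}
    (hf : DifferentiableAt ℝ f x)
    (hqc : ∀ t ∈ Set.Icc (0 : ℝ) 1, f ((1 - t) • x + t • y) ≤ max (f x) (f y))
    (hyx : f y ≤ f x) : inner ℝ (gradient f x) (y - x) ≤ 0 := by
  have hmax : IsMaxOn f (segment ℝ x y) x := by
    intro z hz
    rw [segment_eq_image] at hz
    obtain ⟨t, ht, rfl⟩ := hz
    exact (hqc t ht).trans (max_le le_rfl hyx)
  have := hmax.localize.hasFDerivWithinAt_nonpos
    hf.hasGradientAt.hasFDerivAt.hasFDerivWithinAt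
    (sub_mem_posTangentConeAt_of_segment_subset subset_rfl)
  simpa using this

theorem stmt_18 {n m : ℕ} (hm : 0 < m) (f : Fin m → E n → ℝ)
    (hf : ∀ i, ContDiff ℝ 1 (f i)) (hqc : VecQuasiConvex f) (β σ : ℝ)
    (x v : ℕ → E n) (t : ℕ → ℝ)
    (hmethod : IsInexactSDMethod f β σ x v t)
    (hscal : ∀ k, ∃ w : Fin m → ℝ, (∀ i, 0 ≤ w i) ∧ (∑ i, w i) = 1 ∧
      v k = -∑ i, w i • gradient (f i) (x k))
    (xt : E n) (hxt : ∀ k, ∀ i, f i xt ≤ f i (x k)) :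
    ∀ k, ‖x (k + 1) - xt‖ ^ 2 ≤ ‖x k - xt‖ ^ 2 + t k ^ 2 * ‖v k‖ ^ 2 := by
  intro k
  obtain ⟨w, hw, -, hv⟩ := hscal k
  obtain ⟨j, hj, -⟩ := hmethod.step_mem k
  have ht : 0 ≤ t k := hj ▸ by positivity
  have hdir : (inner ℝ (x k - xt) (v k) : ℝ) ≤ 0 := by
    have hneg : (inner ℝ (x k - xt) (v k) : ℝ)
        = ∑ i, w i * inner ℝ (gradient (f i) (x k)) (xt - x k) := by
      rw [hv, ← neg_sub xt, inner_neg_neg, real_inner_comm, sum_inner]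
      simp only [real_inner_smul_left]
    rw [hneg]
    refine Finset.sum_nonpos fun i _ => mul_nonpos_of_nonneg_of_nonpos (hw i) ?_
    exact inner_gradient_nonpos_of_quasiconvex ((hf i).differentiable one_ne_zero _)
      (fun s hs => hqc _ _ s hs i) (hxt k i)
  rw [hmethod.update, add_sub_right_comm, norm_add_sq_real, real_inner_smul_right, norm_smul,
    mul_pow, Real.norm_eq_abs, sq_abs]
  linarith [mul_nonpos_of_nonneg_of_nonpos ht hdir]
end
end
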